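/- Let k ∈ ℤ, m,n ∈ ℕ, and let x ∈ A(S^7_q) ⊗_B A(S^7_q) satisfy χ(x) = 1 ⊗ r^{k,m,n}. Then χ(−q^{3+(|k|−k)/2} z_1 x z_2* + q^{2+(|k|−k)/2} z_2* x z_1 − q^{(k+|k|)/2} z_3* x z_4 + q^{1+(k+|k|)/2} z_4 x z_3*) = 1 ⊗ r^{k,m,n+1}, where products are taken in the A(S^7_q)-bimodule A(S^7_q) ⊗_B A(S^7_q). -/

import Mathlib

open scoped TensorProduct

noncomputable section

namespace QIB

/-- Generators of `A(U_q(4))`: the matrix entries `t i j` and the extra generator `D_q⁻¹`. -/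
abbrev genU : Type := (Fin 4 × Fin 4) ⊕ Unit

abbrev FU : Type := FreeAlgebra ℂ genU

def T (i j : Fin 4) : FU := FreeAlgebra.ι ℂ (Sum.inl (i, j))

def Dinv0 : FU := FreeAlgebra.ι ℂ (Sum.inr ())

/-- The length (number of inversions) of a permutation of `Fin 4`. -/
def plen (σ : Equiv.Perm (Fin 4)) : ℕ :=
  ((Finset.univ : Finset (Fin 4 × Fin 4)).filter fun p => p.1 < p.2 ∧ σ p.2 < σ p.1).card

/-- The quantum determinant, as an element of the free algebra. -/
def Dq0 (q : ℝ) : FU :=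
  ∑ σ : Equiv.Perm (Fin 4),
    ((-(q : ℂ)) ^ plen σ) • (T (σ 0) 0 * T (σ 1) 1 * T (σ 2) 2 * T (σ 3) 3)

/-- The defining relations of `A(U_q(4))`. -/
inductive relU (q : ℝ) : FU → FU → Prop
  | col {i j k : Fin 4} : i < j → relU q (T i k * T j k) ((q : ℂ) • (T j k * T i k))
  | row {i j k : Fin 4} : i < j → relU q (T k i * T k j) ((q : ℂ) • (T k j * T k i))
  | comm {i j k l : Fin 4} : i < j → k < l → relU q (T i l * T j k) (T j k * T i l)
  | qcom {i j k l : Fin 4} : i < j → k < l →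
      relU q (T i k * T j l - T j l * T i k) (((q : ℂ) - (q : ℂ)⁻¹) • (T j k * T i l))
  | dr : relU q (Dq0 q * Dinv0) 1
  | dl : relU q (Dinv0 * Dq0 q) 1

variable (q : ℝ)

/-- The algebra `A(U_q(4))`. -/
abbrev AU : Type := RingQuot (relU q)

/-- The generators `t i j` of `A(U_q(4))` (indices are 0-based). -/
def tt (i j : Fin 4) : AU q := RingQuot.mkAlgHom ℂ (relU q) (T i j)

/-- The generator `D_q⁻¹`. -/
def dI : AU q := RingQuot.mkAlgHom ℂ (relU q) Dinv0

/-- The quantum determinant `D_q` in `A(U_q(4))`. -/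
def Dq : AU q := RingQuot.mkAlgHom ℂ (relU q) (Dq0 q)

/-- The spanning set `R` of relation elements (0-based indices). -/
def Rset : Set (AU q) :=
  {tt q 0 2, tt q 2 0, tt q 0 3, tt q 3 0, tt q 1 3, tt q 3 1, tt q 1 2, tt q 2 1,
   tt q 0 0 - tt q 3 3, tt q 0 1 + tt q 3 2, tt q 1 0 + tt q 2 3, tt q 1 1 - tt q 2 2,
   tt q 0 0 * tt q 1 1 - (q : ℂ) • (tt q 0 1 * tt q 1 0) - 1}

/-- The right ideal `ℛ = R · A(U_q(4))`, as a `ℂ`-submodule. -/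
def RIdeal : Submodule ℂ (AU q) :=
  Submodule.span ℂ {y | ∃ x ∈ Rset q, ∃ a : AU q, y = x * a}

/-- The coalgebra `C = A(U_q(4)) / ℛ`. -/
abbrev Cq : Type := AU q ⧸ RIdeal q

/-- The canonical projection `r : A(U_q(4)) → C`. -/
def rr : AU q →ₗ[ℂ] Cq q := (RIdeal q).mkQ

lemma RIdeal_mul_right {y : AU q} (hy : y ∈ RIdeal q) (c : AU q) : y * c ∈ RIdeal q := by
  induction hy using Submodule.span_induction with
  | mem x hx =>
      obtain ⟨x0, hx0, a, rfl⟩ := hx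
      exact Submodule.subset_span ⟨x0, hx0, a * c, by rw [mul_assoc]⟩
  | zero => simp
  | add u v _ _ hu hv => simpa [add_mul] using (RIdeal q).add_mem hu hv
  | smul a u _ hu => simpa [smul_mul_assoc] using (RIdeal q).smul_mem a hu

/-- Auxiliary map for the right `A(U_q(4))`-module structure of `C`:
right multiplication by `c` descends to the quotient. -/
def cactAux (c : AU q) : Cq q →ₗ[ℂ] Cq q :=
  Submodule.liftQ (RIdeal q) ((RIdeal q).mkQ ∘ₗ LinearMap.mulRight ℂ c)
    (by
      intro y hy
      simp only [LinearMap.mem_ker, LinearMap.comp_apply, LinearMap.mulRight_apply,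
        Submodule.mkQ_apply, Submodule.Quotient.mk_eq_zero]
      exact RIdeal_mul_right q hy c)

@[simp] lemma cactAux_mk (c a : AU q) :
    cactAux q c (Submodule.Quotient.mk a) = (Submodule.Quotient.mk (a * c) : Cq q) := by
  simp [cactAux]

/-- The right `A(U_q(4))`-module structure `r(t) · t' := r(t t')` of `C`,
as a bilinear map `A(U_q(4)) →ₗ C →ₗ C`, `(c, x) ↦ x · c`. -/
def cact : AU q →ₗ[ℂ] Cq q →ₗ[ℂ] Cq q where
  toFun c := cactAux q c
  map_add' c c' := by
    refine LinearMap.ext fun x => ?_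
    obtain ⟨a, rfl⟩ := Submodule.Quotient.mk_surjective _ x
    simp only [cactAux_mk, mul_add, Submodule.Quotient.mk_add, LinearMap.add_apply]
  map_smul' s c := by
    refine LinearMap.ext fun x => ?_
    obtain ⟨a, rfl⟩ := Submodule.Quotient.mk_surjective _ x
    simp only [cactAux_mk, mul_smul_comm, Submodule.Quotient.mk_smul, RingHom.id_apply, LinearMap.smul_apply]

@[simp] lemma cact_mk (c a : AU q) : cact q c (rr q a) = rr q (a * c) := by
  simp [cact, rr]

/-- θ(k) = 1 for k ≥ 0 and 0 for k < 0. -/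
def thetaZ (k : ℤ) : ℂ := if 0 ≤ k then 1 else 0

/-- The linear basis elements `r^{k,m,n}` of `C`, given as representatives in `A(U_q(4))`. -/
def bas (k : ℤ) (m n : ℕ) : AU q :=
  if 0 ≤ k then tt q 0 0 ^ k.toNat * tt q 0 1 ^ m * tt q 1 0 ^ n
  else tt q 0 1 ^ m * tt q 1 0 ^ n * tt q 1 1 ^ (-k).toNat

/-! ### The quantum seven-sphere -/

/-- Generators of `A(S⁷_q)`: `(i, false)` is `z_i`, `(i, true)` is `z_i^*`. -/
abbrev genS : Type := Fin 4 × Bool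

abbrev FS : Type := FreeAlgebra ℂ genS

def Z0 (i : Fin 4) : FS := FreeAlgebra.ι ℂ (i, false)

def Zs0 (i : Fin 4) : FS := FreeAlgebra.ι ℂ (i, true)

/-- The defining relations of the ∗-algebra `A(S⁷_q)` (including the ∗-conjugate of the
first family of relations, so that the relation set is closed under the involution). -/
inductive relS (q : ℝ) : FS → FS → Prop
  | zz {i j : Fin 4} : i < j → relS q (Z0 i * Z0 j) ((q : ℂ) • (Z0 j * Z0 i))
  | ss {i j : Fin 4} : i < j → relS q (Zs0 j * Zs0 i) ((q : ℂ) • (Zs0 i * Zs0 j))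
  | sz {i j : Fin 4} : i ≠ j → relS q (Zs0 j * Z0 i) ((q : ℂ) • (Z0 i * Zs0 j))
  | szz {k : Fin 4} : relS q (Zs0 k * Z0 k)
      (Z0 k * Zs0 k + (1 - (q : ℂ) ^ 2) •
        ∑ j ∈ Finset.univ.filter (· < k), Z0 j * Zs0 j)
  | sum1 : relS q (∑ k : Fin 4, Z0 k * Zs0 k) 1

/-- The algebra `P = A(S⁷_q)`. -/
abbrev PA : Type := RingQuot (relS q)

/-- The generators `z_i` of `A(S⁷_q)` (0-based index). -/
def z (i : Fin 4) : PA q := RingQuot.mkAlgHom ℂ (relS q) (Z0 i)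

/-- The generators `z_i^*` of `A(S⁷_q)` (0-based index). -/
def zs (i : Fin 4) : PA q := RingQuot.mkAlgHom ℂ (relS q) (Zs0 i)

/-- The element `R = z₁ z₁^* + z₂ z₂^*` of `A(S⁷_q)`. -/
def RRe [StarRing (PA q)] : PA q := z q 0 * star (z q 0) + z q 1 * star (z q 1)

/-- The element `a = z₁ z₄^* − z₂ z₃^*` of `A(S⁷_q)`. -/
def aa [StarRing (PA q)] : PA q := z q 0 * star (z q 3) - z q 1 * star (z q 2)

/-- The element `b = z₁ z₃ + q⁻¹ z₂ z₄` of `A(S⁷_q)`. -/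
def bb : PA q := z q 0 * z q 2 + (q : ℂ)⁻¹ • (z q 1 * z q 3)

/-- The elements `a_n = z₁ z₄^* − qⁿ z₂ z₃^*` of `A(S⁷_q)`. -/
def aN [StarRing (PA q)] (n : ℤ) : PA q :=
  z q 0 * star (z q 3) - ((q : ℂ) ^ n) • (z q 1 * star (z q 2))

/-- The elements `b_n = z₁ z₃ + q^{n−1} z₂ z₄` of `A(S⁷_q)`. -/
def bN (n : ℤ) : PA q := z q 0 * z q 2 + ((q : ℂ) ^ (n - 1)) • (z q 1 * z q 3)

/-! ### The coaction, the coinvariants and the canonical map -/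

variable (δ : PA q →ₐ[ℂ] PA q ⊗[ℂ] AU q)

/-- `Δ_r := (id ⊗ r) ∘ Δ : A(S⁷_q) → A(S⁷_q) ⊗ C`, built from the
`A(U_q(4))`-coaction `δ`. -/
def Dr : PA q →ₗ[ℂ] PA q ⊗[ℂ] Cq q :=
  (LinearMap.lTensor (PA q) (rr q)) ∘ₗ δ.toLinearMap

/-- The set of coinvariants `B = A(Σ⁴_q) = {a | Δ_r(a) = a ⊗ r(1)}`. -/
def Bset : Set (PA q) := {a : PA q | Dr q δ a = a ⊗ₜ[ℂ] rr q 1}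

/-- The subspace of `P ⊗ P` spanned by the elements `(u b) ⊗ v − u ⊗ (b v)` with `b`
a coinvariant; quotienting by it produces the balanced tensor product `P ⊗_B P`. -/
def relT : Submodule ℂ (PA q ⊗[ℂ] PA q) :=
  Submodule.span ℂ
    {x : PA q ⊗[ℂ] PA q | ∃ u v b : PA q, b ∈ Bset q δ ∧
      x = (u * b) ⊗ₜ[ℂ] v - u ⊗ₜ[ℂ] (b * v)}

set_option maxSynthPendingDepth 3

/-- The balanced tensor product `P ⊗_B P` over the coinvariant subalgebra `B = A(Σ⁴_q)`. -/
abbrev PBP : Type := (PA q ⊗[ℂ] PA q) ⧸ relT q δ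

/-- The canonical projection `P ⊗ P → P ⊗_B P`. -/
def mkT : PA q ⊗[ℂ] PA q →ₗ[ℂ] PBP q δ := (relT q δ).mkQ

lemma relT_map_lmul (p : PA q) {x : PA q ⊗[ℂ] PA q} (hx : x ∈ relT q δ) :
    TensorProduct.map (LinearMap.mulLeft ℂ p) LinearMap.id x ∈ relT q δ := by
  induction hx using Submodule.span_induction with
  | mem y hy =>
      obtain ⟨u, v, b, hb, rfl⟩ := hy
      refine Submodule.subset_span ⟨p * u, v, b, hb, ?_⟩
      simp [TensorProduct.map_tmul, mul_assoc]
  | zero => simp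
  | add u v _ _ hu hv => simpa [map_add] using Submodule.add_mem _ hu hv
  | smul a u _ hu => simpa [map_smul] using Submodule.smul_mem _ a hu

lemma relT_map_rmul (p : PA q) {x : PA q ⊗[ℂ] PA q} (hx : x ∈ relT q δ) :
    TensorProduct.map LinearMap.id (LinearMap.mulRight ℂ p) x ∈ relT q δ := by
  induction hx using Submodule.span_induction with
  | mem y hy =>
      obtain ⟨u, v, b, hb, rfl⟩ := hy
      refine Submodule.subset_span ⟨u, v * p, b, hb, ?_⟩
      simp [TensorProduct.map_tmul, mul_assoc]
  | zero => simp
  | add u v _ _ hu hv => simpa [map_add] using Submodule.add_mem _ hu hv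
  | smul a u _ hu => simpa [map_smul] using Submodule.smul_mem _ a hu

/-- Left multiplication by `p ∈ P` on the bimodule `P ⊗_B P`. -/
def lact (p : PA q) : PBP q δ →ₗ[ℂ] PBP q δ :=
  Submodule.liftQ (relT q δ)
    ((relT q δ).mkQ ∘ₗ TensorProduct.map (LinearMap.mulLeft ℂ p) LinearMap.id)
    (by
      intro x hx
      simp only [LinearMap.mem_ker, LinearMap.comp_apply, Submodule.mkQ_apply,
        Submodule.Quotient.mk_eq_zero]
      exact relT_map_lmul q δ p hx)

/-- Right multiplication by `p ∈ P` on the bimodule `P ⊗_B P`. -/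
def ract (p : PA q) : PBP q δ →ₗ[ℂ] PBP q δ :=
  Submodule.liftQ (relT q δ)
    ((relT q δ).mkQ ∘ₗ TensorProduct.map LinearMap.id (LinearMap.mulRight ℂ p))
    (by
      intro x hx
      simp only [LinearMap.mem_ker, LinearMap.comp_apply, Submodule.mkQ_apply,
        Submodule.Quotient.mk_eq_zero]
      exact relT_map_rmul q δ p hx)

/-- The structure map of the right action `◁` of `A(S⁷_q)` on `A(S⁷_q) ⊗ C`:
on simple tensors, `(u ⊗ x) ⊗ (w ⊗ y) ↦ (u w) ⊗ (x · y)`.  The action is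
`(u ⊗ x) ◁ v = triMap ((u ⊗ x) ⊗ δ v) = Σ u v₍₀₎ ⊗ x · v₍₁₎`. -/
def triMap : (PA q ⊗[ℂ] Cq q) ⊗[ℂ] (PA q ⊗[ℂ] AU q) →ₗ[ℂ] PA q ⊗[ℂ] Cq q :=
  (TensorProduct.map (LinearMap.mul' ℂ (PA q)) (TensorProduct.lift (LinearMap.flip (cact q)))) ∘ₗ
    (TensorProduct.tensorTensorTensorComm ℂ (PA q) (Cq q) (PA q) (AU q)).toLinearMap

/-! ### Helper lemmas -/

lemma tt_col {i j : Fin 4} (k : Fin 4) (h : i < j) :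
    tt q i k * tt q j k = (q : ℂ) • (tt q j k * tt q i k) := by
  have := RingQuot.mkAlgHom_rel ℂ (relU.col (q := q) (k := k) h)
  simp only [map_mul, map_smul] at this
  exact this

lemma tt_row {i j : Fin 4} (k : Fin 4) (h : i < j) :
    tt q k i * tt q k j = (q : ℂ) • (tt q k j * tt q k i) := by
  have := RingQuot.mkAlgHom_rel ℂ (relU.row (q := q) (k := k) h)
  simp only [map_mul, map_smul] at this
  exact this

lemma tt_comm {i j k l : Fin 4} (h : i < j) (h' : k < l) :
    tt q i l * tt q j k = tt q j k * tt q i l := by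
  have := RingQuot.mkAlgHom_rel ℂ (relU.comm (q := q) h h')
  simp only [map_mul, map_smul] at this
  exact this

lemma tt_qcom {i j k l : Fin 4} (h : i < j) (h' : k < l) :
    tt q i k * tt q j l - tt q j l * tt q i k
      = ((q : ℂ) - (q : ℂ)⁻¹) • (tt q j k * tt q i l) := by
  have := RingQuot.mkAlgHom_rel ℂ (relU.qcom (q := q) h h')
  simp only [map_mul, map_smul, map_sub] at this
  exact this

/-- Off-diagonal-block index pairs. -/
def offB (i j : Fin 4) : Prop := (i < 2 ∧ 2 ≤ j) ∨ (2 ≤ i ∧ j < 2)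

/-- The right ideal generated by the off-diagonal blocks. -/
def JJ : Submodule ℂ (AU q) :=
  Submodule.span ℂ {y | ∃ i j, offB i j ∧ ∃ a : AU q, y = tt q i j * a}

lemma JJ_mem {i j : Fin 4} (h : offB i j) (a : AU q) : tt q i j * a ∈ JJ q :=
  Submodule.subset_span ⟨i, j, h, a, rfl⟩

lemma JJ_mul_right {y : AU q} (hy : y ∈ JJ q) (c : AU q) : y * c ∈ JJ q := by
  induction hy using Submodule.span_induction with
  | mem x hx =>
      obtain ⟨i, j, h, a, rfl⟩ := hx
      rw [mul_assoc]
      exact JJ_mem q h _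
  | zero => rw [zero_mul]; exact Submodule.zero_mem _
  | add u v _ _ hu hv => rw [add_mul]; exact Submodule.add_mem _ hu hv
  | smul a u _ hu => rw [smul_mul_assoc]; exact Submodule.smul_mem _ a hu

lemma Rset_mul_mem {x : AU q} (hx : x ∈ Rset q) (a : AU q) : x * a ∈ RIdeal q :=
  Submodule.subset_span ⟨x, hx, a, rfl⟩

lemma offB_Rset {i j : Fin 4} (h : offB i j) : tt q i j ∈ Rset q := by
  unfold offB at h
  fin_cases i <;> fin_cases j <;> first
    | (exfalso; revert h; decide)
    | simp [Rset]

lemma JJ_le : JJ q ≤ RIdeal q := by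
  refine Submodule.span_le.2 ?_
  rintro _ ⟨i, j, h, a, rfl⟩
  exact Rset_mul_mem q (offB_Rset q h) a

lemma gen_off {p1 p2 i j : Fin 4} (h1 : p1 < 2) (h2 : p2 < 2) (h : offB i j) :
    tt q p1 p2 * tt q i j ∈ JJ q := by
  rcases h with ⟨hi, hj⟩ | ⟨hi, hj⟩
  · have h2j : p2 < j := lt_of_lt_of_le h2 hj
    rcases lt_trichotomy p1 i with h | h | h
    · have e := tt_qcom q h h2j
      rw [← tt_comm q h h2j] at e
      rw [sub_eq_iff_eq_add.1 e]
      exact Submodule.add_mem _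
        (Submodule.smul_mem _ _ (JJ_mem q (Or.inl ⟨h1, hj⟩) _)) (JJ_mem q (Or.inl ⟨hi, hj⟩) _)
    · subst h
      rw [tt_row q _ h2j]
      exact Submodule.smul_mem _ _ (JJ_mem q (Or.inl ⟨hi, hj⟩) _)
    · rw [← tt_comm q h h2j]
      exact JJ_mem q (Or.inl ⟨hi, hj⟩) _
  · have h1i : p1 < i := lt_of_lt_of_le h1 hi
    rcases lt_trichotomy p2 j with h | h | h
    · rw [sub_eq_iff_eq_add.1 (tt_qcom q h1i h)]
      exact Submodule.add_mem _
        (Submodule.smul_mem _ _ (JJ_mem q (Or.inr ⟨hi, h2⟩) _)) (JJ_mem q (Or.inr ⟨hi, hj⟩) _)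
    · subst h
      rw [tt_col q _ h1i]
      exact Submodule.smul_mem _ _ (JJ_mem q (Or.inr ⟨hi, hj⟩) _)
    · rw [tt_comm q h1i h]
      exact JJ_mem q (Or.inr ⟨hi, hj⟩) _

lemma gen_diag {p1 p2 i j : Fin 4} (h1 : p1 < 2) (h2 : p2 < 2) (hi : 2 ≤ i) (hj : 2 ≤ j) :
    tt q p1 p2 * tt q i j - tt q i j * tt q p1 p2 ∈ JJ q := by
  rw [tt_qcom q (lt_of_lt_of_le h1 hi) (lt_of_lt_of_le h2 hj)]
  exact Submodule.smul_mem _ _ (JJ_mem q (Or.inr ⟨hi, h2⟩) _)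

/-- The subalgebra generated by the upper left block. -/
def HH : Subalgebra ℂ (AU q) :=
  Algebra.adjoin ℂ {y | ∃ i j : Fin 4, i < 2 ∧ j < 2 ∧ y = tt q i j}

lemma HH_gen {i j : Fin 4} (hi : i < 2) (hj : j < 2) : tt q i j ∈ HH q :=
  Algebra.subset_adjoin ⟨i, j, hi, hj, rfl⟩

lemma HH_mul_JJ {h : AU q} (hh : h ∈ HH q) : ∀ y ∈ JJ q, h * y ∈ JJ q := by
  induction hh using Algebra.adjoin_induction with
  | mem x hx =>
      obtain ⟨p1, p2, h1, h2, rfl⟩ := hx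
      intro y hy
      induction hy using Submodule.span_induction with
      | mem y hy =>
          obtain ⟨i, j, hij, a, rfl⟩ := hy
          rw [← mul_assoc]
          exact JJ_mul_right q (gen_off q h1 h2 hij) a
      | zero => rw [mul_zero]; exact Submodule.zero_mem _
      | add u v _ _ hu hv => rw [mul_add]; exact Submodule.add_mem _ hu hv
      | smul a u _ hu => rw [mul_smul_comm]; exact Submodule.smul_mem _ a hu
  | algebraMap c =>
      intro y hy
      rw [← Algebra.smul_def]
      exact Submodule.smul_mem _ _ hy
  | add u v _ _ hu hv =>
      intro y hy
      rw [add_mul]; exact Submodule.add_mem _ (hu y hy) (hv y hy)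
  | mul u v _ _ hu hv =>
      intro y hy
      rw [mul_assoc]; exact hu _ (hv y hy)

lemma HH_diag {h : AU q} (hh : h ∈ HH q) {i j : Fin 4} (hi : 2 ≤ i) (hj : 2 ≤ j) :
    h * tt q i j - tt q i j * h ∈ JJ q := by
  induction hh using Algebra.adjoin_induction with
  | mem x hx =>
      obtain ⟨p1, p2, h1, h2, rfl⟩ := hx
      exact gen_diag q h1 h2 hi hj
  | algebraMap c =>
      rw [Algebra.commutes, sub_self]; exact Submodule.zero_mem _
  | add u v _ _ hu hv =>
      rw [add_mul, mul_add, add_sub_add_comm]; exact Submodule.add_mem _ hu hv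
  | mul u v hu0 _ hu hv =>
      have e : u * v * tt q i j - tt q i j * (u * v)
          = u * (v * tt q i j - tt q i j * v) + (u * tt q i j - tt q i j * u) * v := by
        simp only [mul_sub, sub_mul, mul_assoc]; abel
      rw [e]
      exact Submodule.add_mem _ (HH_mul_JJ q hu0 _ hv) (JJ_mul_right q hu v)

lemma rr_zero {x : AU q} (hx : x ∈ RIdeal q) : rr q x = 0 := by
  simpa [rr] using hx

lemma rr_off {h : AU q} (hh : h ∈ HH q) {i j : Fin 4} (hij : offB i j) (y : AU q) :
    rr q (h * tt q i j * y) = 0 := by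
  apply rr_zero
  apply JJ_le
  rw [mul_assoc]
  exact HH_mul_JJ q hh _ (JJ_mem q hij y)

lemma rr_diag {h : AU q} (hh : h ∈ HH q) {i j : Fin 4} (hi : 2 ≤ i) (hj : 2 ≤ j) (y : AU q) :
    rr q (h * tt q i j * y) = rr q (tt q i j * (h * y)) := by
  rw [← sub_eq_zero, ← map_sub]
  apply rr_zero
  apply JJ_le
  rw [← mul_assoc, ← sub_mul]
  exact JJ_mul_right q (HH_diag q hh hi hj) y

lemma rr_33 (y : AU q) : rr q (tt q 3 3 * y) = rr q (tt q 0 0 * y) := by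
  symm
  rw [← sub_eq_zero, ← map_sub, ← sub_mul]
  exact rr_zero q (Rset_mul_mem q (by simp [Rset]) y)

lemma rr_22 (y : AU q) : rr q (tt q 2 2 * y) = rr q (tt q 1 1 * y) := by
  symm
  rw [← sub_eq_zero, ← map_sub, ← sub_mul]
  exact rr_zero q (Rset_mul_mem q (by simp [Rset]) y)

lemma rr_32 (y : AU q) : rr q (tt q 3 2 * y) = - rr q (tt q 0 1 * y) := by
  symm
  rw [neg_eq_iff_add_eq_zero, ← map_add, ← add_mul]
  exact rr_zero q (Rset_mul_mem q (by simp [Rset]) y)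

lemma rr_23 (y : AU q) : rr q (tt q 2 3 * y) = - rr q (tt q 1 0 * y) := by
  symm
  rw [neg_eq_iff_add_eq_zero, ← map_add, ← add_mul]
  exact rr_zero q (Rset_mul_mem q (by simp [Rset]) y)

/-- The quantum determinant of the upper left block. -/
def det2 : AU q := tt q 0 0 * tt q 1 1 - (q : ℂ) • (tt q 0 1 * tt q 1 0)

lemma rr_det (y : AU q) : rr q (det2 q * y) = rr q y := by
  rw [← sub_eq_zero, ← map_sub]
  have : det2 q * y - y = (det2 q - 1) * y := by rw [sub_mul, one_mul]
  rw [this]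
  exact rr_zero q (Rset_mul_mem q (by simp [Rset, det2]) y)

lemma e_ab : tt q 0 0 * tt q 0 1 = (q : ℂ) • (tt q 0 1 * tt q 0 0) := tt_row q 0 (by decide)
lemma e_ac : tt q 0 0 * tt q 1 0 = (q : ℂ) • (tt q 1 0 * tt q 0 0) := tt_col q 0 (by decide)
lemma e_bd : tt q 0 1 * tt q 1 1 = (q : ℂ) • (tt q 1 1 * tt q 0 1) := tt_col q 1 (by decide)
lemma e_cd : tt q 1 0 * tt q 1 1 = (q : ℂ) • (tt q 1 1 * tt q 1 0) := tt_row q 1 (by decide)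
lemma e_bc : tt q 0 1 * tt q 1 0 = tt q 1 0 * tt q 0 1 := tt_comm q (by decide) (by decide)
lemma e_ad : tt q 0 0 * tt q 1 1 - tt q 1 1 * tt q 0 0
    = ((q : ℂ) - (q : ℂ)⁻¹) • (tt q 0 1 * tt q 1 0) := by
  rw [e_bc]; exact tt_qcom q (by decide) (by decide)

/-- Centrality of the 2x2 quantum determinant, in an abstract algebra. -/
lemma det_central {A : Type*} [Ring A] [Algebra ℂ A] (s : ℂ) (hs : s ≠ 0) (a b c d : A)
    (ab : a * b = s • (b * a)) (ac : a * c = s • (c * a)) (bd : b * d = s • (d * b))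
    (cd : c * d = s • (d * c)) (bc : b * c = c * b)
    (ad : a * d - d * a = (s - s⁻¹) • (b * c)) :
    a * (a * d - s • (b * c)) = (a * d - s • (b * c)) * a ∧
    b * (a * d - s • (b * c)) = (a * d - s • (b * c)) * b ∧
    c * (a * d - s • (b * c)) = (a * d - s • (b * c)) * c ∧
    d * (a * d - s • (b * c)) = (a * d - s • (b * c)) * d := by
  have hda : d * a = a * d - (s - s⁻¹) • (b * c) := by rw [← ad]; abel
  have hba : b * a = s⁻¹ • (a * b) := by rw [ab, smul_smul, inv_mul_cancel₀ hs, one_smul]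
  have hca : c * a = s⁻¹ • (a * c) := by rw [ac, smul_smul, inv_mul_cancel₀ hs, one_smul]
  have hdb : d * b = s⁻¹ • (b * d) := by rw [bd, smul_smul, inv_mul_cancel₀ hs, one_smul]
  have hdc : d * c = s⁻¹ • (c * d) := by rw [cd, smul_smul, inv_mul_cancel₀ hs, one_smul]
  have hcb := bc.symm
  have hda' : ∀ y, d * (a * y) = a * (d * y) - (s - s⁻¹) • (b * (c * y)) := fun y => by
    rw [← mul_assoc, hda, sub_mul, smul_mul_assoc, mul_assoc, mul_assoc]
  have hba' : ∀ y, b * (a * y) = s⁻¹ • (a * (b * y)) := fun y => by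
    rw [← mul_assoc, hba, smul_mul_assoc, mul_assoc]
  have hca' : ∀ y, c * (a * y) = s⁻¹ • (a * (c * y)) := fun y => by
    rw [← mul_assoc, hca, smul_mul_assoc, mul_assoc]
  have hdb' : ∀ y, d * (b * y) = s⁻¹ • (b * (d * y)) := fun y => by
    rw [← mul_assoc, hdb, smul_mul_assoc, mul_assoc]
  have hcb' : ∀ y, c * (b * y) = b * (c * y) := fun y => by
    rw [← mul_assoc, hcb, mul_assoc]
  refine ⟨?_, ?_, ?_, ?_⟩ <;>
  · simp only [mul_sub, sub_mul, mul_assoc, smul_mul_assoc, mul_smul_comm, hda, hba, hca, hdb, hdc,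
      hcb, hda', hba', hca', hdb', hcb', smul_sub, smul_smul]
    try (match_scalars <;> field_simp <;> try ring)

lemma HH_det (hq : (q : ℂ) ≠ 0) {h : AU q} (hh : h ∈ HH q) : h * det2 q = det2 q * h := by
  obtain ⟨h1, h2, h3, h4⟩ := det_central (q : ℂ) hq (tt q 0 0) (tt q 0 1) (tt q 1 0) (tt q 1 1)
    (e_ab q) (e_ac q) (e_bd q) (e_cd q) (e_bc q) (e_ad q)
  induction hh using Algebra.adjoin_induction with
  | mem x hx =>
      obtain ⟨i, j, hi, hj, rfl⟩ := hx
      have hi' : i = 0 ∨ i = 1 := by revert hi; revert i; decide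
      have hj' : j = 0 ∨ j = 1 := by revert hj; revert j; decide
      rcases hi' with rfl | rfl <;> rcases hj' with rfl | rfl
      exacts [h1, h2, h3, h4]
  | algebraMap c => exact Algebra.commutes _ _
  | add u v _ _ hu hv => rw [add_mul, mul_add, hu, hv]
  | mul u v _ _ hu hv => rw [mul_assoc, hv, ← mul_assoc, hu, mul_assoc]

lemma rr_mul_congr {x y : AU q} (h : rr q x = rr q y) (c : AU q) : rr q (x * c) = rr q (y * c) := by
  rw [← cact_mk, ← cact_mk, h]

lemma rr_hdet (hq : (q : ℂ) ≠ 0) {h : AU q} (hh : h ∈ HH q) (y : AU q) :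
    rr q (h * (det2 q * y)) = rr q (h * y) := by
  rw [← mul_assoc, HH_det q hq hh, mul_assoc, rr_det]

/-- Action of `S (t_{2j})`. -/
lemma rr_S1 (hq : (q : ℂ) ≠ 0) (s : Fin 4 → Fin 4 → AU q)
    (hs : ∀ i j : Fin 4, ∑ k : Fin 4, tt q i k * s k j = if i = j then 1 else 0)
    {h : AU q} (hh : h ∈ HH q) (j : Fin 4) :
    rr q (h * s 1 j) = if j = 0 then -((q : ℂ) • rr q (h * tt q 1 0))
      else if j = 1 then rr q (h * tt q 0 0) else 0 := by
  have hc : h * tt q 1 0 ∈ HH q := mul_mem hh (HH_gen q (by decide) (by decide))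
  have ha : h * tt q 0 0 ∈ HH q := mul_mem hh (HH_gen q (by decide) (by decide))
  have A0 := congrArg (fun w => rr q (h * tt q 1 0 * w)) (hs 0 j)
  have A1 := congrArg (fun w => rr q (h * tt q 0 0 * w)) (hs 1 j)
  simp only [Fin.sum_univ_four, mul_add, map_add, ← mul_assoc] at A0 A1
  rw [rr_off q hc (i := 0) (j := 2) (Or.inl (by decide)),
    rr_off q hc (i := 0) (j := 3) (Or.inl (by decide)), add_zero, add_zero] at A0
  rw [rr_off q ha (i := 1) (j := 2) (Or.inl (by decide)),
    rr_off q ha (i := 1) (j := 3) (Or.inl (by decide)), add_zero, add_zero] at A1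
  have K1 : rr q (h * tt q 0 0 * tt q 1 0 * s 0 j)
      = (q : ℂ) • rr q (h * tt q 1 0 * tt q 0 0 * s 0 j) := by
    rw [mul_assoc h, e_ac, mul_smul_comm, smul_mul_assoc, map_smul]
    simp only [mul_assoc]
  have K2 : rr q (h * tt q 0 0 * tt q 1 1 * s 1 j)
      - (q : ℂ) • rr q (h * tt q 1 0 * tt q 0 1 * s 1 j) = rr q (h * s 1 j) := by
    rw [← rr_hdet q hq hh, det2, e_bc, sub_mul, mul_sub, map_sub, smul_mul_assoc, mul_smul_comm,
      map_smul]
    simp only [mul_assoc]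
  have K : rr q (h * s 1 j) = rr q (h * tt q 0 0 * if 1 = j then 1 else 0)
      - (q : ℂ) • rr q (h * tt q 1 0 * if 0 = j then 1 else 0) := by
    rw [← A0, ← A1, K1, ← K2, smul_add]; abel
  rw [K]
  fin_cases j <;> simp

/-- Action of `S (t_{3j})`. -/
lemma rr_S2 (hq : (q : ℂ) ≠ 0) (s : Fin 4 → Fin 4 → AU q)
    (hs : ∀ i j : Fin 4, ∑ k : Fin 4, tt q i k * s k j = if i = j then 1 else 0)
    {h : AU q} (hh : h ∈ HH q) (j : Fin 4) :
    rr q (h * s 2 j) = if j = 2 then rr q (tt q 0 0 * h)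
      else if j = 3 then (q : ℂ)⁻¹ • rr q (tt q 1 0 * h) else 0 := by
  have hc : tt q 1 0 * h ∈ HH q := mul_mem (HH_gen q (by decide) (by decide)) hh
  have ha : tt q 0 0 * h ∈ HH q := mul_mem (HH_gen q (by decide) (by decide)) hh
  have A0 := congrArg (fun w => rr q (tt q 0 0 * h * w)) (hs 2 j)
  have A1 := congrArg (fun w => rr q (tt q 1 0 * h * w)) (hs 3 j)
  simp only [Fin.sum_univ_four, mul_add, map_add] at A0 A1
  simp only [← mul_assoc (tt q 0 0 * h), ← mul_assoc (tt q 1 0 * h)] at A0 A1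
  rw [rr_off q ha (i := 2) (j := 0) (Or.inr (by decide)),
    rr_off q ha (i := 2) (j := 1) (Or.inr (by decide)), zero_add, zero_add,
    rr_diag q ha (by decide) (by decide), rr_diag q ha (by decide) (by decide),
    rr_22, rr_23] at A0
  rw [rr_off q hc (i := 3) (j := 0) (Or.inr (by decide)),
    rr_off q hc (i := 3) (j := 1) (Or.inr (by decide)), zero_add, zero_add,
    rr_diag q hc (by decide) (by decide), rr_diag q hc (by decide) (by decide),
    rr_32, rr_33] at A1
  have K1 : rr q (tt q 0 0 * (tt q 1 0 * h * s 3 j))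
      = (q : ℂ) • rr q (tt q 1 0 * (tt q 0 0 * h * s 3 j)) := by
    rw [mul_assoc, ← mul_assoc (tt q 0 0), e_ac, smul_mul_assoc, map_smul]
    simp only [mul_assoc]
  have hdet : det2 q = tt q 1 1 * tt q 0 0 - (q : ℂ)⁻¹ • (tt q 0 1 * tt q 1 0) := by
    rw [det2, sub_eq_iff_eq_add.1 (e_ad q)]
    module
  have K2 : rr q (tt q 1 1 * (tt q 0 0 * h * s 2 j))
      - (q : ℂ)⁻¹ • rr q (tt q 0 1 * (tt q 1 0 * h * s 2 j)) = rr q (h * s 2 j) := by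
    rw [← rr_det q (h * s 2 j), hdet, sub_mul, map_sub, smul_mul_assoc, map_smul]
    simp only [mul_assoc]
  have K : rr q (h * s 2 j) = rr q (tt q 0 0 * h * if 2 = j then 1 else 0)
      + (q : ℂ)⁻¹ • rr q (tt q 1 0 * h * if 3 = j then 1 else 0) := by
    rw [← A0, ← A1, K1, ← K2, smul_add, smul_smul, inv_mul_cancel₀ hq, one_smul, smul_neg]; abel
  rw [K]
  fin_cases j <;> simp

lemma HH_bas (k : ℤ) (m n : ℕ) : bas q k m n ∈ HH q := by
  have h : ∀ i j : Fin 4, i < 2 → j < 2 → ∀ e : ℕ, tt q i j ^ e ∈ HH q :=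
    fun i j hi hj e => pow_mem (HH_gen q hi hj) e
  unfold bas
  split_ifs
  · exact mul_mem (mul_mem (h 0 0 (by decide) (by decide) _) (h 0 1 (by decide) (by decide) _))
      (h 1 0 (by decide) (by decide) _)
  · exact mul_mem (mul_mem (h 0 1 (by decide) (by decide) _) (h 1 0 (by decide) (by decide) _))
      (h 1 1 (by decide) (by decide) _)

lemma pow_comm_smul {A : Type*} [Ring A] [Algebra ℂ A] (s : ℂ) (x y : A)
    (h : x * y = s • (y * x)) (e : ℕ) : x ^ e * y = s ^ e • (y * x ^ e) := by
  induction e with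
  | zero => simp
  | succ e ih =>
      rw [pow_succ, mul_assoc, h, mul_smul_comm, ← mul_assoc, ih, smul_mul_assoc, smul_smul,
        mul_assoc, ← pow_succ']

lemma comm_pow_smul {A : Type*} [Ring A] [Algebra ℂ A] (s : ℂ) (x y : A)
    (h : x * y = s • (y * x)) (e : ℕ) : x * y ^ e = s ^ e • (y ^ e * x) := by
  induction e with
  | zero => simp
  | succ e ih =>
      rw [pow_succ, ← mul_assoc, ih, smul_mul_assoc, mul_assoc, h, mul_smul_comm, smul_smul,
        ← mul_assoc, ← pow_succ]

lemma bas_right (k : ℤ) (m n : ℕ) :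
    (q : ℂ) ^ ((|k| - k) / 2) • (bas q k m n * tt q 1 0) = bas q k m (n + 1) := by
  unfold bas
  split_ifs with hk
  · have : (|k| - k) / 2 = 0 := by rw [abs_of_nonneg hk]; simp
    rw [this, zpow_zero, one_smul, pow_succ, ← mul_assoc]
  · have : (|k| - k) / 2 = ((-k).toNat : ℤ) := by rw [abs_of_neg (by omega)]; omega
    rw [this, zpow_natCast, mul_assoc, ← mul_smul_comm,
      ← comm_pow_smul (q : ℂ) _ _ (e_cd q), pow_succ]
    simp only [mul_assoc]

lemma bas_left (k : ℤ) (m n : ℕ) :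
    (q : ℂ) ^ ((k + |k|) / 2) • (tt q 1 0 * bas q k m n) = bas q k m (n + 1) := by
  have hcb : tt q 1 0 * tt q 0 1 ^ m = tt q 0 1 ^ m * tt q 1 0 :=
    ((show Commute (tt q 1 0) (tt q 0 1) from (e_bc q).symm).pow_right m).eq
  unfold bas
  split_ifs with hk
  · have : (k + |k|) / 2 = (k.toNat : ℤ) := by rw [abs_of_nonneg hk]; omega
    rw [this, zpow_natCast, ← mul_assoc, ← mul_assoc, ← smul_mul_assoc, ← smul_mul_assoc,
      ← pow_comm_smul (q : ℂ) _ _ (e_ac q), mul_assoc _ (tt q 1 0), hcb, pow_succ']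
    simp only [mul_assoc]
  · have : (k + |k|) / 2 = 0 := by rw [abs_of_neg (by omega)]; simp
    rw [this, zpow_zero, one_smul, ← mul_assoc, ← mul_assoc, hcb, pow_succ']
    simp only [mul_assoc]

/-! Sphere relations -/

lemma zs_z {i j : Fin 4} (h : i ≠ j) : zs q j * z q i = (q : ℂ) • (z q i * zs q j) := by
  have := RingQuot.mkAlgHom_rel ℂ (relS.sz (q := q) h)
  simp only [map_mul, map_smul] at this
  exact this

lemma zs_z_self (k : Fin 4) : zs q k * z q k = z q k * zs q k + (1 - (q : ℂ) ^ 2) •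
    ∑ j ∈ Finset.univ.filter (· < k), z q j * zs q j := by
  have := RingQuot.mkAlgHom_rel ℂ (relS.szz (q := q) (k := k))
  simp only [map_mul, map_smul, map_add, map_sum] at this
  exact this

lemma z_sum : z q 0 * zs q 0 + z q 1 * zs q 1 + z q 2 * zs q 2 + z q 3 * zs q 3 = 1 := by
  have := RingQuot.mkAlgHom_rel ℂ (relS.sum1 (q := q))
  simp only [Fin.sum_univ_four, map_add, map_mul, map_one] at this
  exact this

/-! The canonical map -/

lemma triMap_tmul (u v : PA q) (x : Cq q) (y : AU q) :
    triMap q ((u ⊗ₜ x) ⊗ₜ (v ⊗ₜ y)) = (u * v) ⊗ₜ[ℂ] (cact q y x) := by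
  simp [triMap]

lemma tri_aux (p u : PA q) (X Y : PA q ⊗[ℂ] AU q) :
    TensorProduct.map (LinearMap.mulLeft ℂ (p * u)) LinearMap.id
      (LinearMap.lTensor (PA q) (rr q) (X * Y)) =
    TensorProduct.map (LinearMap.mulLeft ℂ p) LinearMap.id
      (triMap q ((TensorProduct.map (LinearMap.mulLeft ℂ u) LinearMap.id
        (LinearMap.lTensor (PA q) (rr q) X)) ⊗ₜ Y)) := by
  induction X using TensorProduct.induction_on with
  | zero => simp only [zero_mul, map_zero, TensorProduct.zero_tmul]
  | add X X' hX hX' => simp only [add_mul, map_add, TensorProduct.add_tmul, hX, hX']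
  | tmul a b =>
    induction Y using TensorProduct.induction_on with
    | zero => simp only [mul_zero, map_zero, TensorProduct.tmul_zero]
    | add Y Y' hY hY' => simp only [mul_add, map_add, TensorProduct.tmul_add, hY, hY']
    | tmul c d =>
      simp only [Algebra.TensorProduct.tmul_mul_tmul, LinearMap.lTensor_tmul,
        TensorProduct.map_tmul, LinearMap.mulLeft_apply, LinearMap.id_apply, triMap_tmul, cact_mk,
        mul_assoc]

lemma chi_bimod (chi : PBP q δ →ₗ[ℂ] PA q ⊗[ℂ] Cq q)
    (hchi : ∀ p' p : PA q, chi (mkT q δ (p' ⊗ₜ[ℂ] p)) =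
      TensorProduct.map (LinearMap.mulLeft ℂ p') LinearMap.id (Dr q δ p))
    (p v : PA q) (x : PBP q δ) :
    chi (lact q δ p (ract q δ v x)) =
      TensorProduct.map (LinearMap.mulLeft ℂ p) LinearMap.id (triMap q (chi x ⊗ₜ δ v)) := by
  obtain ⟨w, rfl⟩ := Submodule.mkQ_surjective _ x
  induction w using TensorProduct.induction_on with
  | zero => simp only [map_zero, TensorProduct.zero_tmul]
  | add a b ha hb => simp only [map_add, TensorProduct.add_tmul, ha, hb]
  | tmul a b =>
    have e : lact q δ p (ract q δ v ((relT q δ).mkQ (a ⊗ₜ b)))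
        = mkT q δ ((p * a) ⊗ₜ (b * v)) := rfl
    have e' : (relT q δ).mkQ (a ⊗ₜ b) = mkT q δ (a ⊗ₜ b) := rfl
    rw [e, e', hchi, hchi]
    simp only [Dr, LinearMap.comp_apply, AlgHom.toLinearMap_apply, map_mul]
    exact tri_aux q p a (δ b) (δ v)

lemma chi_val (chi : PBP q δ →ₗ[ℂ] PA q ⊗[ℂ] Cq q)
    (hchi : ∀ p' p : PA q, chi (mkT q δ (p' ⊗ₜ[ℂ] p)) =
      TensorProduct.map (LinearMap.mulLeft ℂ p') LinearMap.id (Dr q δ p))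
    (p v : PA q) (x : PBP q δ) (h : AU q) (hx : chi x = 1 ⊗ₜ[ℂ] rr q h)
    (w : Fin 4 → PA q) (t : Fin 4 → AU q) (hv : δ v = ∑ j : Fin 4, w j ⊗ₜ[ℂ] t j) :
    chi (lact q δ p (ract q δ v x)) =
      ∑ j : Fin 4, (p * w j) ⊗ₜ[ℂ] rr q (h * t j) := by
  rw [chi_bimod q δ chi hchi, hx, hv, TensorProduct.tmul_sum, map_sum, map_sum]
  simp only [triMap_tmul, cact_mk, TensorProduct.map_tmul, one_mul, LinearMap.mulLeft_apply,
    LinearMap.id_apply]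

theorem tau_step_n_up (q : ℝ) (hq0 : 0 < q) (hq1 : q < 1)
    [StarRing (AU q)] [StarModule ℂ (AU q)]
    (S : AU q →ₗ[ℂ] AU q)
    (hSanti : ∀ x y : AU q, S (x * y) = S y * S x) (hS1 : S 1 = 1)
    (hSleft : ∀ i j : Fin 4, ∑ k : Fin 4, S (tt q i k) * tt q k j = if i = j then 1 else 0)
    (hSright : ∀ i j : Fin 4, ∑ k : Fin 4, tt q i k * S (tt q k j) = if i = j then 1 else 0)
    (hSD : S (Dq q) = dI q) (hSDi : S (dI q) = Dq q)
    (hstarT : ∀ i j : Fin 4, star (tt q i j) = S (tt q j i))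
    (hstarD : star (Dq q) = dI q)
    [StarRing (PA q)] [StarModule ℂ (PA q)]
    (hstarz : ∀ i : Fin 4, star (z q i) = zs q i)
    (δ : PA q →ₐ[ℂ] PA q ⊗[ℂ] AU q)
    (hδz : ∀ i : Fin 4, δ (z q i) = ∑ j : Fin 4, z q j ⊗ₜ[ℂ] tt q j i)
    (hδzs : ∀ i : Fin 4, δ (zs q i) = ∑ j : Fin 4, zs q j ⊗ₜ[ℂ] star (tt q j i))
    (chi : PBP q δ →ₗ[ℂ] PA q ⊗[ℂ] Cq q)
    (hchi : ∀ p' p : PA q, chi (mkT q δ (p' ⊗ₜ[ℂ] p)) =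
      TensorProduct.map (LinearMap.mulLeft ℂ p') LinearMap.id (Dr q δ p))
    (k : ℤ) (m n : ℕ) (x : PBP q δ)
    (hx : chi x = 1 ⊗ₜ[ℂ] rr q (bas q k m n))
        : chi (-(((q : ℂ) ^ (3 + (|k| - k) / 2)) • lact q δ (z q 0) (ract q δ (star (z q 1)) x))
        + ((q : ℂ) ^ (2 + (|k| - k) / 2)) • lact q δ (star (z q 1)) (ract q δ (z q 0) x)
        - ((q : ℂ) ^ ((k + |k|) / 2)) • lact q δ (star (z q 2)) (ract q δ (z q 3) x)
        + ((q : ℂ) ^ (1 + (k + |k|) / 2)) • lact q δ (z q 3) (ract q δ (star (z q 2)) x))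
      = 1 ⊗ₜ[ℂ] rr q (bas q k m (n + 1)) := by
  have hq : (q : ℂ) ≠ 0 := by exact_mod_cast hq0.ne'
  simp only [hstarz]
  set h := bas q k m n with hh
  have hH : h ∈ HH q := HH_bas q k m n
  have V1 := chi_val q δ chi hchi (z q 0) (zs q 1) x h hx _ _ (hδzs 1)
  have V2 := chi_val q δ chi hchi (zs q 1) (z q 0) x h hx _ _ (hδz 0)
  have V3 := chi_val q δ chi hchi (zs q 2) (z q 3) x h hx _ _ (hδz 3)
  have V4 := chi_val q δ chi hchi (z q 3) (zs q 2) x h hx _ _ (hδzs 2)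
  simp only [hstarT] at V1 V4
  have s1 := rr_S1 q hq (fun i j => S (tt q i j)) hSright hH
  have s2 := rr_S2 q hq (fun i j => S (tt q i j)) hSright hH
  have o1 : rr q (h * tt q 2 0) = 0 := by
    simpa using rr_off q hH (i := 2) (j := 0) (Or.inr (by decide)) 1
  have o2 : rr q (h * tt q 3 0) = 0 := by
    simpa using rr_off q hH (i := 3) (j := 0) (Or.inr (by decide)) 1
  have o3 : rr q (h * tt q 0 3) = 0 := by
    simpa using rr_off q hH (i := 0) (j := 3) (Or.inl (by decide)) 1
  have o4 : rr q (h * tt q 1 3) = 0 := by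
    simpa using rr_off q hH (i := 1) (j := 3) (Or.inl (by decide)) 1
  have d1 : rr q (h * tt q 2 3) = - rr q (tt q 1 0 * h) := by
    have := rr_diag q hH (i := 2) (j := 3) (by decide) (by decide) 1
    rwa [mul_one, mul_one, rr_23] at this
  have d2 : rr q (h * tt q 3 3) = rr q (tt q 0 0 * h) := by
    have := rr_diag q hH (i := 3) (j := 3) (by decide) (by decide) 1
    rwa [mul_one, mul_one, rr_33] at this
  have s10 := s1 0
  have s11 := s1 1
  have s12 := s1 2
  have s13 := s1 3
  have s20 := s2 0
  have s21 := s2 1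
  have s22 := s2 2
  have s23 := s2 3
  simp only [Fin.isValue, Fin.reduceEq, if_true, if_false] at s10 s11 s12 s13 s20 s21 s22 s23
  rw [Fin.sum_univ_four, s10, s11, s12, s13] at V1
  rw [Fin.sum_univ_four, o1, o2] at V2
  rw [Fin.sum_univ_four, o3, o4, d1, d2] at V3
  rw [Fin.sum_univ_four, s20, s21, s22, s23] at V4
  have z1 := zs_z_self q 1
  have z2 := zs_z_self q 2
  rw [show (Finset.univ.filter (· < (1 : Fin 4))) = {0} by decide, Finset.sum_singleton] at z1
  rw [show (Finset.univ.filter (· < (2 : Fin 4))) = {0, 1} by decide,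
    Finset.sum_pair (by decide)] at z2
  rw [zs_z q (i := 0) (j := 1) (by decide), z1] at V2
  rw [zs_z q (i := 3) (j := 2) (by decide), z2] at V3
  have bR := congrArg (rr q) (bas_right q k m n)
  have bL := congrArg (rr q) (bas_left q k m n)
  rw [map_smul, ← hh] at bR bL
  simp only [map_add, map_sub, map_neg, map_smul, V1, V2, V3, V4]
  rw [zpow_add₀ hq, zpow_add₀ hq, zpow_add₀ hq]
  generalize (q : ℂ) ^ ((|k| - k) / 2) = e at *
  generalize (q : ℂ) ^ ((k + |k|) / 2) = f at *
  generalize rr q (bas q k m (n + 1)) = g at *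
  generalize rr q (h * tt q 1 0) = g1 at *
  generalize rr q (tt q 1 0 * h) = g2 at *
  rw [show ((q : ℂ) ^ (3 : ℤ)) = (q : ℂ) ^ 3 by norm_cast,
    show ((q : ℂ) ^ (2 : ℤ)) = (q : ℂ) ^ 2 by norm_cast, zpow_one]
  have fin : ∀ y : PA q, e • (y ⊗ₜ[ℂ] g1) = y ⊗ₜ[ℂ] g := fun y => by
    rw [← bR, TensorProduct.tmul_smul]
  have fin2 : ∀ y : PA q, f • (y ⊗ₜ[ℂ] g2) = y ⊗ₜ[ℂ] g := fun y => by
    rw [← bL, TensorProduct.tmul_smul]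
  rw [← z_sum q]
  simp only [TensorProduct.tmul_zero, TensorProduct.tmul_neg, TensorProduct.tmul_smul,
    TensorProduct.add_tmul, ← TensorProduct.smul_tmul', add_zero, zero_add]
  simp only [← fin2]
  have fin3 : ∀ y : PA q, f • (y ⊗ₜ[ℂ] g2) = e • (y ⊗ₜ[ℂ] g1) := fun y => by rw [fin, fin2]
  have f0 := fin3 (z q 0 * zs q 0)
  have f1 := fin3 (z q 1 * zs q 1)
  clear V1 V2 V3 V4 s1 s2 s10 s11 s12 s13 s20 s21 s22 s23
  linear_combination (norm := (match_scalars <;> field_simp <;> try ring)) (-(q:ℂ)^2) • f0 - ((q:ℂ)^2) • f1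

end QIB
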